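/- There does not exist a binary self-dual [48,24,10] code with an automorphism of order 3 of type 3-(12,12) (twelve 3-cycles and twelve fixed points). (Proof idea: the subcode E_σ(C) with fixed-point coordinates deleted corresponds, under the map φ, to a Hermitian self-dual [12,6] code over the field P ≅ F_4; the maximum minimum distance of a quaternary Hermitian self-dual [12,6] code is 4, so E_σ(C) would contain a nonzero codeword of weight at most 2·4 = 8 < 10, a contradiction.) -/

import Mathlib

open Finset

/-- Hamming weight of a binary vector. -/
def wt {ι : Type*} [Fintype ι] (v : ι → ZMod 2) : ℕ :=
  (Finset.univ.filter fun i => v i ≠ 0).card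

/-- Dual of a binary code under the standard dot product. -/
def dualCode {ι : Type*} [Fintype ι] (C : Submodule (ZMod 2) (ι → ZMod 2)) :
    Submodule (ZMod 2) (ι → ZMod 2) where
  carrier := {x | ∀ c ∈ C, ∑ i, x i * c i = 0}
  add_mem' := by
    intro a b ha hb c hc
    have := ha c hc; have := hb c hc
    simp only [Pi.add_apply, add_mul, Finset.sum_add_distrib]
    simp [ha c hc, hb c hc]
  zero_mem' := by intro c hc; simp
  smul_mem' := by
    intro r a ha c hc
    simp only [Pi.smul_apply, smul_eq_mul, mul_assoc, ← Finset.mul_sum]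
    simp [ha c hc]

/-- Fixed subcode F_σ(C). -/
def fixedCode {ι : Type*} (σ : Equiv.Perm ι) (C : Submodule (ZMod 2) (ι → ZMod 2)) :
    Submodule (ZMod 2) (ι → ZMod 2) where
  carrier := {v | v ∈ C ∧ v ∘ σ = v}
  add_mem' := by
    rintro a b ⟨ha, ha'⟩ ⟨hb, hb'⟩
    refine ⟨C.add_mem ha hb, ?_⟩
    funext i
    simpa using congrFun (congrArg₂ (· + ·) ha' hb') i
  zero_mem' := ⟨C.zero_mem, rfl⟩
  smul_mem' := by
    rintro r a ⟨ha, ha'⟩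
    exact ⟨C.smul_mem r ha, by funext i; simpa using congrArg (r • ·) (congrFun ha' i)⟩

/-- Subcode E_σ(C): codewords with even weight on each cycle (and zero on fixed points). -/
def evenCode {ι : Type*} (p : ℕ) (σ : Equiv.Perm ι) (C : Submodule (ZMod 2) (ι → ZMod 2)) :
    Submodule (ZMod 2) (ι → ZMod 2) where
  carrier := {v | v ∈ C ∧ ∀ i, ∑ k ∈ Finset.range p, v ((σ ^ k) i) = 0}
  add_mem' := by
    rintro a b ⟨ha, ha'⟩ ⟨hb, hb'⟩
    refine ⟨C.add_mem ha hb, fun i => ?_⟩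
    simp [Finset.sum_add_distrib, ha' i, hb' i]
  zero_mem' := ⟨C.zero_mem, by simp⟩
  smul_mem' := by
    rintro r a ⟨ha, ha'⟩
    refine ⟨C.smul_mem r ha, fun i => ?_⟩
    simp only [Pi.smul_apply, smul_eq_mul]
    rw [← Finset.mul_sum, ha' i, mul_zero]

/-- The field with four elements, the pair `(a, b)` standing for `a + b * ω` with
`ω ^ 2 = ω + 1`. -/
def F4 : Type := ZMod 2 × ZMod 2

namespace F4

instance : DecidableEq F4 := inferInstanceAs (DecidableEq (ZMod 2 × ZMod 2))

instance : Fintype F4 := inferInstanceAs (Fintype (ZMod 2 × ZMod 2))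

instance : AddCommGroup F4 := inferInstanceAs (AddCommGroup (ZMod 2 × ZMod 2))

instance : Mul F4 := ⟨fun x y => (x.1 * y.1 + x.2 * y.2, x.1 * y.2 + x.2 * y.1 + x.2 * y.2)⟩

instance : One F4 := ⟨((1 : ZMod 2), (0 : ZMod 2))⟩

instance : CommRing F4 :=
  { (inferInstance : AddCommGroup F4) with
    mul := (· * ·)
    one := 1
    left_distrib := by decide
    right_distrib := by decide
    zero_mul := by decide
    mul_zero := by decide
    mul_assoc := by decide
    one_mul := by decide
    mul_one := by decide
    mul_comm := by decide }

instance : Field F4 :=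
  { (inferInstance : CommRing F4) with
    inv := fun x => x * x
    exists_pair_ne := ⟨0, 1, by decide⟩
    mul_inv_cancel := by decide
    inv_zero := by decide
    nnqsmul := _
    nnqsmul_def := fun _ _ => rfl
    qsmul := _
    qsmul_def := fun _ _ => rfl }

/-- A primitive cube root of unity. -/
def ω : F4 := ((0 : ZMod 2), (1 : ZMod 2))

/-- The element `a + b * ω`. -/
def mk (a b : ZMod 2) : F4 := (a, b)

/-- The inclusion of the prime field. -/
def ofBit : ZMod 2 →+* F4 where
  toFun a := mk a 0
  map_zero' := rfl
  map_one' := rfl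
  map_add' := by decide
  map_mul' := by decide

/-- The discrete logarithm to the base `ω`, with junk value `0` at `0`. -/
def log (x : F4) : ZMod 3 := if x = ω then 1 else if x = ω ^ 2 then 2 else 0

theorem log_mul_sq : ∀ x y : F4, x ≠ 0 → y ≠ 0 → log (x * y ^ 2) = log x - log y := by
  decide

set_option synthInstance.maxSize 1000 in
set_option synthInstance.maxHeartbeats 200000 in
/-- Four nonzero elements with sum zero, no three of them equal, have the pattern `a, a, b, b`,
so none of them is the product of all four. -/
theorem log_ne_sum_log : ∀ r s t u : F4, r ≠ 0 → s ≠ 0 → t ≠ 0 → u ≠ 0 → r + s + t + u = 0 →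
    ¬ (s = t ∧ t = u) → ¬ (r = s ∧ s = t) → ¬ (r = s ∧ s = u) → ¬ (r = t ∧ t = u) →
    log r ≠ log r + log s + log t + log u := by
  decide +kernel

theorem card_eq : Fintype.card F4 = 4 := by decide

theorem hermitian_expand : ∀ u₀ u₁ u₂ v₀ v₁ v₂ : ZMod 2,
    (ofBit u₀ + ofBit u₁ * ω + ofBit u₂ * ω ^ 2) *
      (ofBit v₀ + ofBit v₁ * ω + ofBit v₂ * ω ^ 2) ^ 2 =
    ofBit (u₀ * v₀ + u₁ * v₁ + u₂ * v₂) + ofBit (u₀ * v₁ + u₁ * v₂ + u₂ * v₀) * ω ^ 2 +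
      ofBit (u₀ * v₂ + u₁ * v₀ + u₂ * v₁) * ω := by
  decide +kernel

theorem weight_le : ∀ a b c : ZMod 2, a + b + c = 0 →
    (if a ≠ 0 then 1 else 0) + (if b ≠ 0 then 1 else 0) + (if c ≠ 0 then 1 else 0) ≤
      2 * (if ofBit a + ofBit b * ω + ofBit c * ω ^ 2 ≠ 0 then 1 else 0) := by
  decide +kernel

theorem mul_sq_eq_ofBit : ∀ x : F4, x * x ^ 2 = ofBit (if x ≠ 0 then 1 else 0) := by decide

theorem eq_zero_or_eq_pow_ω : ∀ x : F4, x = 0 ∨ x = 1 ∨ x = ω ∨ x = ω * ω := by decide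

end F4

section linear
variable {K ι : Type*} [Field K] [Fintype ι]

theorem two_mul_finrank_le_card_of_selfOrthogonal [DecidableEq ι] (W : Submodule K (ι → K))
    (h : ∀ u ∈ W, ∀ v ∈ W, ∑ i, u i * v i = 0) :
    2 * Module.finrank K W ≤ Fintype.card ι := by
  have hle : W.map (dotProductEquiv K ι).toLinearMap ≤ W.dualAnnihilator := by
    rintro _ ⟨u, hu, rfl⟩
    rw [Submodule.mem_dualAnnihilator]
    exact fun v hv => h u hu v hv
  have h1 := Submodule.finrank_mono hle
  have h2 := Subspace.finrank_add_finrank_dualAnnihilator_eq W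
  rw [LinearEquiv.finrank_map_eq] at h1
  rw [Module.finrank_fintype_fun_eq_card] at h2
  omega

/-- A code of dimension at least `n` has `n` codewords forming an identity matrix on some `n`
coordinates. -/
theorem exists_systematic (D : Submodule K (ι → K)) {n : ℕ} (hn : n ≤ Module.finrank K D) :
    ∃ (I : Fin n → ι) (u : Fin n → ι → K), (∀ a, u a ∈ D) ∧
      ∀ a b, u a (I b) = if a = b then 1 else 0 := by
  classical
  let f : ι → Module.Dual K D := fun i => (LinearMap.proj i).comp D.subtype
  have hspan : Submodule.span K (Set.range f) = ⊤ := by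
    have hco : (Submodule.span K (Set.range f)).dualCoannihilator = ⊥ := by
      rw [eq_bot_iff]
      intro v hv
      rw [Submodule.mem_dualCoannihilator] at hv
      exact Subtype.ext (funext fun i => hv (f i) (Submodule.subset_span ⟨i, rfl⟩))
    rw [← Subspace.dualCoannihilator_dualAnnihilator_eq (W := Submodule.span K (Set.range f)), hco,
      Submodule.dualAnnihilator_bot]
  obtain ⟨g, hg, hgs, -⟩ := Submodule.exists_fun_fin_finrank_span_eq K (Set.range f)
  choose J hJ using hg
  have hm : Module.finrank K (Submodule.span K (Set.range f)) = Module.finrank K D := by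
    rw [hspan, finrank_top, Subspace.dual_finrank_eq]
  have hinj : Function.Injective (LinearMap.pi g) := by
    rw [← LinearMap.ker_eq_bot, eq_bot_iff]
    intro v hv
    have hv' : ∀ ψ ∈ Submodule.span K (Set.range g), ψ v = 0 := by
      intro ψ hψ
      induction hψ using Submodule.span_induction with
      | mem _ hx => obtain ⟨a, rfl⟩ := hx; exact congrFun hv a
      | zero => rfl
      | add _ _ _ _ hx hy => simp [hx, hy]
      | smul _ _ _ hx => simp [hx]
    exact Subtype.ext (funext fun i =>
      hv' (f i) (by rw [hgs]; exact Submodule.subset_span ⟨i, rfl⟩))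
  have hsurj : Function.Surjective (LinearMap.pi g) :=
    (LinearMap.injective_iff_surjective_of_finrank_eq_finrank (by simp [hm])).1 hinj
  let e : Fin n → Fin (Module.finrank K (Submodule.span K (Set.range f))) :=
    Fin.castLE (hm ▸ hn)
  have he : Function.Injective e := Fin.castLE_injective _
  choose u hu using fun a => hsurj (Pi.single (e a) 1)
  refine ⟨fun a => J (e a), fun a => u a, fun a => (u a).2, fun a b => ?_⟩
  have h1 : (u a : ι → K) (J (e b)) = g (e b) (u a) := by rw [← hJ]; rfl
  have h2 : g (e b) (u a) = (Pi.single (e a) 1 : _ → K) (e b) := congrFun (hu a) (e b)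
  refine (h1.trans h2).trans ?_
  simp [Pi.single_apply, he.eq_iff, eq_comm]

end linear

set_option synthInstance.maxSize 1000 in
set_option synthInstance.maxHeartbeats 200000 in
/-- Two rows of a normalized logarithm matrix, `p` and `q` being the entries in the columns
where the other row vanishes, have different sums. -/
theorem sum_ne_sum_of_differences : ∀ p y₁ y₂ y₃ q z₁ z₂ z₃ : ZMod 3,
    p ≠ p + y₁ + y₂ + y₃ → y₁ ≠ p + y₁ + y₂ + y₃ → y₂ ≠ p + y₁ + y₂ + y₃ →
    y₃ ≠ p + y₁ + y₂ + y₃ →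
    q ≠ q + z₁ + z₂ + z₃ → z₁ ≠ q + z₁ + z₂ + z₃ → z₂ ≠ q + z₁ + z₂ + z₃ →
    z₃ ≠ q + z₁ + z₂ + z₃ →
    0 ≠ (y₁ - z₁) + (y₂ - z₂) + (y₃ - z₃) →
    y₁ - z₁ ≠ (y₁ - z₁) + (y₂ - z₂) + (y₃ - z₃) →
    y₂ - z₂ ≠ (y₁ - z₁) + (y₂ - z₂) + (y₃ - z₃) →
    y₃ - z₃ ≠ (y₁ - z₁) + (y₂ - z₂) + (y₃ - z₃) →
    p + y₁ + y₂ + y₃ ≠ q + z₁ + z₂ + z₃ := by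
  decide +kernel

theorem three_eq_zero_zmod_three : (3 : ZMod 3) = 0 := rfl

/-- There is no `6 × 6` matrix over `ZMod 3` such that for any two rows the difference at a column
off the two diagonal positions is never the sum of the four such differences. After normalizing
the row and column of index `0`, the sums of the five other rows would be pairwise distinct. -/
theorem no_log_matrix (m : Fin 6 → Fin 6 → ZMod 3)
    (h : ∀ i j k₁ k₂ k₃ k₄, [i, j, k₁, k₂, k₃, k₄].Nodup →
      m i k₁ - m j k₁ ≠
        (m i k₁ - m j k₁) + (m i k₂ - m j k₂) + (m i k₃ - m j k₃) + (m i k₄ - m j k₄)) :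
    False := by
  let S : Fin 6 → ZMod 3 := fun i => ∑ l ∈ univ \ {0, i}, (m i l - m 0 l - m i 0)
  obtain ⟨a, b, hab, hS⟩ := Fintype.exists_ne_map_eq_of_card_lt (fun a : Fin 5 => S a.succ)
    (by simp)
  obtain ⟨k₁, k₂, k₃, hnd, hi, hj⟩ : ∃ k₁ k₂ k₃ : Fin 6,
      [0, a.succ, b.succ, k₁, k₂, k₃].Nodup ∧ univ \ {0, a.succ} = {b.succ, k₁, k₂, k₃} ∧
      univ \ {0, b.succ} = {a.succ, k₁, k₂, k₃} := by
    clear hS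
    revert a b
    clear S h m
    decide +kernel
  generalize a.succ = i at *
  generalize b.succ = j at *
  simp only [S, hi, hj] at hS
  simp only [List.nodup_cons, List.mem_cons, List.not_mem_nil, or_false, not_or] at hnd
  obtain ⟨⟨h0i, h0j, h01, h02, h03⟩, ⟨hij, hi1, hi2, hi3⟩, ⟨hj1, hj2, hj3⟩, ⟨h12, h13⟩, h23, -⟩ :=
    hnd
  rw [sum_insert (by simp [*]), sum_insert (by simp [*]), sum_insert (by simp [*]), sum_singleton,
    sum_insert (by simp [*]), sum_insert (by simp [*]), sum_insert (by simp [*]), sum_singleton,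
    ← add_assoc, ← add_assoc, ← add_assoc, ← add_assoc] at hS
  have nd : ∀ i j k₁ k₂ k₃ k₄ : Fin 6, i ≠ j ∧ i ≠ k₁ ∧ i ≠ k₂ ∧ i ≠ k₃ ∧ i ≠ k₄ ∧ j ≠ k₁ ∧
      j ≠ k₂ ∧ j ≠ k₃ ∧ j ≠ k₄ ∧ k₁ ≠ k₂ ∧ k₁ ≠ k₃ ∧ k₁ ≠ k₄ ∧ k₂ ≠ k₃ ∧ k₂ ≠ k₄ ∧ k₃ ≠ k₄ →
      [i, j, k₁, k₂, k₃, k₄].Nodup := by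
    intro i j k₁ k₂ k₃ k₄ h
    simp [h]
  refine sum_ne_sum_of_differences _ _ _ _ _ _ _ _ ?_ ?_ ?_ ?_ ?_ ?_ ?_ ?_ ?_ ?_ ?_ ?_ hS
  · refine fun e => h i 0 j k₁ k₂ k₃ (nd _ _ _ _ _ _ (by grind)) ?_
    linear_combination e - m i 0 * three_eq_zero_zmod_three
  · refine fun e => h i 0 k₁ j k₂ k₃ (nd _ _ _ _ _ _ (by grind)) ?_
    linear_combination e - m i 0 * three_eq_zero_zmod_three
  · refine fun e => h i 0 k₂ j k₁ k₃ (nd _ _ _ _ _ _ (by grind)) ?_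
    linear_combination e - m i 0 * three_eq_zero_zmod_three
  · refine fun e => h i 0 k₃ j k₁ k₂ (nd _ _ _ _ _ _ (by grind)) ?_
    linear_combination e - m i 0 * three_eq_zero_zmod_three
  · refine fun e => h j 0 i k₁ k₂ k₃ (nd _ _ _ _ _ _ (by grind)) ?_
    linear_combination e - m j 0 * three_eq_zero_zmod_three
  · refine fun e => h j 0 k₁ i k₂ k₃ (nd _ _ _ _ _ _ (by grind)) ?_
    linear_combination e - m j 0 * three_eq_zero_zmod_three
  · refine fun e => h j 0 k₂ i k₁ k₃ (nd _ _ _ _ _ _ (by grind)) ?_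
    linear_combination e - m j 0 * three_eq_zero_zmod_three
  · refine fun e => h j 0 k₃ i k₁ k₂ (nd _ _ _ _ _ _ (by grind)) ?_
    linear_combination e - m j 0 * three_eq_zero_zmod_three
  · refine fun e => h i j 0 k₁ k₂ k₃ (nd _ _ _ _ _ _ (by grind)) ?_
    linear_combination e - (m i 0 - m j 0) * three_eq_zero_zmod_three
  · refine fun e => h i j k₁ 0 k₂ k₃ (nd _ _ _ _ _ _ (by grind)) ?_
    linear_combination e - (m i 0 - m j 0) * three_eq_zero_zmod_three
  · refine fun e => h i j k₂ 0 k₁ k₃ (nd _ _ _ _ _ _ (by grind)) ?_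
    linear_combination e - (m i 0 - m j 0) * three_eq_zero_zmod_three
  · refine fun e => h i j k₃ 0 k₁ k₂ (nd _ _ _ _ _ _ (by grind)) ?_
    linear_combination e - (m i 0 - m j 0) * three_eq_zero_zmod_three

theorem F4.eq_mul_of_mul_sq_eq : ∀ x y c : F4, y ≠ 0 → x * y ^ 2 = c → x = c * y := by decide

theorem F4.no_unitary_matrix (M : Fin 6 → Fin 6 → F4) (hz : ∀ a b, M a b = 0 ↔ a = b)
    (hle : ∀ a b, a ≠ b → ∀ c ≠ 0, #{k | M a k = c * M b k} ≤ 2)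
    (ho : ∀ a b, a ≠ b → ∑ k, M a k * M b k ^ 2 = 0) : False := by
  refine no_log_matrix (fun a b => F4.log (M a b)) fun i j k₁ k₂ k₃ k₄ hnd => ?_
  have huniv : ({i, j, k₁, k₂, k₃, k₄} : Finset (Fin 6)) = univ := by
    rw [← card_eq_iff_eq_univ]
    simpa using List.toFinset_card_of_nodup hnd
  simp only [List.nodup_cons, List.mem_cons, List.not_mem_nil, or_false, not_or] at hnd
  obtain ⟨⟨hij, hi1, hi2, hi3, hi4⟩, ⟨hj1, hj2, hj3, hj4⟩, ⟨h12, h13, h14⟩, ⟨h23, h24⟩, h34, -⟩ :=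
    hnd
  have hiz : ∀ k, i ≠ k → M i k ≠ 0 := fun k hk => by simpa [hz]
  have hjz : ∀ k, j ≠ k → M j k ≠ 0 := fun k hk => by simpa [hz]
  have hr : ∀ k, i ≠ k → j ≠ k → M i k * M j k ^ 2 ≠ 0 := fun k h h' =>
    mul_ne_zero (hiz k h) (pow_ne_zero _ (hjz k h'))
  have hsum := ho i j hij
  rw [← huniv, sum_insert (by simp [*]), sum_insert (by simp [*]), sum_insert (by simp [*]),
    sum_insert (by simp [*]), sum_insert (by simp [*]), sum_singleton, (hz i i).2 rfl,
    (hz j j).2 rfl] at hsum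
  have three : ∀ a b c, i ≠ a → i ≠ b → i ≠ c → j ≠ a → j ≠ b → j ≠ c → a ≠ b → a ≠ c → b ≠ c →
      ¬ (M i a * M j a ^ 2 = M i b * M j b ^ 2 ∧ M i b * M j b ^ 2 = M i c * M j c ^ 2) := by
    rintro a b c ia ib ic ja jb jc ab ac bc ⟨e₁, e₂⟩
    have hsub : ({a, b, c} : Finset (Fin 6)) ⊆
        univ.filter fun k => M i k = (M i c * M j c ^ 2) * M j k := by
      intro k hk
      simp only [mem_insert, mem_singleton] at hk
      simp only [mem_filter, mem_univ, true_and]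
      rcases hk with rfl | rfl | rfl
      · exact F4.eq_mul_of_mul_sq_eq _ _ _ (hjz _ ja) (e₁.trans e₂)
      · exact F4.eq_mul_of_mul_sq_eq _ _ _ (hjz _ jb) e₂
      · exact F4.eq_mul_of_mul_sq_eq _ _ _ (hjz _ jc) rfl
    have h3 : #({a, b, c} : Finset (Fin 6)) = 3 := card_eq_three.2 ⟨a, b, c, ab, ac, bc, rfl⟩
    have := card_le_card hsub
    have := hle i j hij _ (hr c ic jc)
    omega
  rw [← F4.log_mul_sq _ _ (hiz _ hi1) (hjz _ hj1), ← F4.log_mul_sq _ _ (hiz _ hi2) (hjz _ hj2),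
    ← F4.log_mul_sq _ _ (hiz _ hi3) (hjz _ hj3), ← F4.log_mul_sq _ _ (hiz _ hi4) (hjz _ hj4)]
  refine F4.log_ne_sum_log _ _ _ _ (hr _ hi1 hj1) (hr _ hi2 hj2) (hr _ hi3 hj3) (hr _ hi4 hj4)
    (by linear_combination hsum) ?_ ?_ ?_ ?_ <;> apply three <;> assumption

theorem F4.even_hammingNorm {ι : Type*} [Fintype ι] (v : ι → F4) (h : ∑ i, v i * v i ^ 2 = 0) :
    Even (hammingNorm v) := by
  have hcast : F4.ofBit (hammingNorm v : ZMod 2) = 0 := by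
    rw [hammingNorm, card_filter, Nat.cast_sum, map_sum]
    refine (sum_congr rfl fun i _ => ?_).trans h
    rw [F4.mul_sq_eq_ofBit]
    push_cast
    rfl
  rw [map_eq_zero] at hcast
  exact (ZMod.natCast_eq_zero_iff_even).1 hcast

/-- A Hermitian self-orthogonal code of length 12 and dimension 6 over the field of four elements
has minimum distance at most 4. -/
theorem no_hermitian_selfDual {ι : Type*} [Fintype ι] [DecidableEq ι]
    (hι : Fintype.card ι = 12) (D : Submodule F4 (ι → F4)) (hdim : 6 ≤ Module.finrank F4 D)
    (horth : ∀ u ∈ D, ∀ v ∈ D, ∑ i, u i * v i ^ 2 = 0)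
    (hmin : ∀ v ∈ D, v ≠ 0 → 5 ≤ hammingNorm v) : False := by
  obtain ⟨I, u, huD, huI⟩ := exists_systematic D hdim
  have hI : Function.Injective I := by
    intro a b hab
    have := huI a b
    rw [← hab, huI a a] at this
    by_contra hne
    simp [hne] at this
  have hsix : ∀ v ∈ D, v ≠ 0 → 6 ≤ hammingNorm v := by
    intro v hv hv0
    have h5 := hmin v hv hv0
    obtain ⟨k, hk⟩ := F4.even_hammingNorm v (horth v hv v hv)
    omega
  let Q : Finset ι := univ \ univ.image I
  have hQ : #Q = 6 := by
    rw [card_univ_sdiff, card_image_of_injective _ hI, hι]; simp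
  have split : ∀ {N : Type} [AddCommMonoid N] (f : ι → N),
      ∑ i, f i = ∑ q ∈ Q, f q + ∑ b, f (I b) := by
    intro N _ f
    rw [← sum_sdiff (subset_univ (univ.image I)), sum_image hI.injOn]
  have norm_split : ∀ v : ι → F4, hammingNorm v =
      #{q ∈ Q | v q ≠ 0} + #{b | v (I b) ≠ 0} := by
    intro v
    rw [hammingNorm, card_filter, split, card_filter, card_filter]
  have hrow : ∀ a, #{q ∈ Q | u a q = 0} = 1 := by
    intro a
    have h0 : u a ≠ 0 := fun h => by simpa [h] using huI a a
    have h6 := hsix _ (huD a) h0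
    obtain ⟨k, hk⟩ := F4.even_hammingNorm _ (horth _ (huD a) _ (huD a))
    have h1 : #{b | u a (I b) ≠ 0} = 1 := by
      simp [huI, filter_eq]
    have h2 := card_filter_add_card_filter_not (s := Q) (fun q => u a q = 0)
    rw [norm_split, h1] at h6 hk
    simp only [← ne_eq] at h2
    omega
  have hagree : ∀ a b, a ≠ b → ∀ c ≠ 0, #{q ∈ Q | u a q = c * u b q} ≤ 2 := by
    intro a b hab c hc
    have hmem : u a - c • u b ∈ D := D.sub_mem (huD a) (D.smul_mem c (huD b))
    have h0 : u a - c • u b ≠ 0 := fun h => by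
      have := congrFun h (I a)
      simp [huI, hab.symm] at this
    have h6 := hsix _ hmem h0
    have h1 : #{x | (u a - c • u b) (I x) ≠ 0} ≤ 2 := by
      refine (card_le_card (t := {a, b}) fun x hx => ?_).trans card_le_two
      by_contra hx'
      simp only [mem_insert, mem_singleton, not_or] at hx'
      simp [huI, Ne.symm hx'.1, Ne.symm hx'.2] at hx
    have h2 := card_filter_add_card_filter_not (s := Q) (fun q => u a q = c * u b q)
    rw [norm_split] at h6
    simp only [Pi.sub_apply, Pi.smul_apply, smul_eq_mul, ne_eq, sub_eq_zero] at h6 h1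
    omega
  choose z hz using fun a => card_eq_one.1 (hrow a)
  have hzero : ∀ a, ∀ q ∈ Q, u a q = 0 ↔ q = z a := by
    intro a q hq
    have := Finset.ext_iff.1 (hz a) q
    simpa [hq] using this
  have hzQ : ∀ a, z a ∈ Q := fun a => by
    have : z a ∈ ({z a} : Finset ι) := mem_singleton_self _
    rw [← hz a] at this
    exact (mem_filter.1 this).1
  have hzinj : Function.Injective z := by
    intro a b hab
    by_contra hne
    have hcover : Q.erase (z a) ⊆ (univ.erase (0 : F4)).biUnion
        fun c => {q ∈ Q | u a q = c * u b q}.erase (z a) := by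
      intro q hq
      obtain ⟨hqz, hq⟩ := mem_erase.1 hq
      have ha : u a q ≠ 0 := by rwa [ne_eq, hzero a q hq]
      have hb : u b q ≠ 0 := by rwa [ne_eq, hzero b q hq, ← hab]
      simp only [mem_biUnion, mem_erase, mem_filter, mem_univ, and_true]
      exact ⟨u a q / u b q, div_ne_zero ha hb, hqz, hq, by field_simp⟩
    have hc := (card_le_card hcover).trans (card_biUnion_le_card_mul _ _ 1 fun c hc => by
      have hmem : z a ∈ {q ∈ Q | u a q = c * u b q} := by
        simp [hzQ, (hzero a _ (hzQ a)).2 rfl, (hzero b _ (hzQ a)).2 hab]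
      rw [card_erase_of_mem hmem]
      have := hagree a b hne c (ne_of_mem_erase hc)
      omega)
    rw [card_erase_of_mem (hzQ a), hQ, card_erase_of_mem (mem_univ _), card_univ, F4.card_eq] at hc
    omega
  have hQz : Q = univ.image z := by
    refine (eq_of_subset_of_card_le (fun q hq => ?_) ?_).symm
    · obtain ⟨a, -, rfl⟩ := mem_image.1 hq
      exact hzQ a
    · rw [hQ, card_image_of_injective _ hzinj]; simp
  refine F4.no_unitary_matrix (fun a b => u a (z b)) ?_ ?_ ?_
  · intro a b
    rw [hzero a _ (hzQ b), hzinj.eq_iff, eq_comm]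
  · intro a b hab c hc
    refine le_trans ?_ (hagree a b hab c hc)
    rw [← card_image_of_injective _ hzinj]
    refine card_le_card fun q hq => ?_
    obtain ⟨k, hk, rfl⟩ := mem_image.1 hq
    exact mem_filter.2 ⟨hzQ k, (mem_filter.1 hk).2⟩
  · intro a b hab
    have h := horth _ (huD a) _ (huD b)
    rw [split, hQz, sum_image hzinj.injOn] at h
    have hI0 : ∑ k, u a (I k) * u b (I k) ^ 2 = 0 := by
      refine sum_eq_zero fun k _ => ?_
      rw [huI, huI]
      by_cases hk : a = k
      · simp [← hk, hab.symm]
      · simp [hk]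
    rwa [hI0, add_zero] at h

/-- The cyclic shift sum `v + v ∘ σ + v ∘ σ ∘ σ`. -/
def cycleSum {ι : Type*} (σ : Equiv.Perm ι) : (ι → ZMod 2) →ₗ[ZMod 2] (ι → ZMod 2) :=
  LinearMap.id + LinearMap.funLeft _ _ σ + LinearMap.funLeft _ _ (σ ∘ σ)

theorem cycleSum_apply {ι : Type*} (σ : Equiv.Perm ι) (v : ι → ZMod 2) (i : ι) :
    cycleSum σ v i = v i + v (σ i) + v (σ (σ i)) := rfl

section cycles
variable {ι : Type*} [Fintype ι] [LinearOrder ι] {σ : Equiv.Perm ι}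

/-- The fixed points of `σ`. -/
def fixedPts (σ : Equiv.Perm ι) : Finset ι := univ.filter fun i => σ i = i

/-- The least elements of the 3-cycles of `σ`. -/
def cycleReps (σ : Equiv.Perm ι) : Finset ι := univ.filter fun i => i < σ i ∧ i < σ (σ i)

theorem sum_eq_sum_fixedPts_add_sum_cycleReps (hσ : ∀ i, σ (σ (σ i)) = i) {N : Type*}
    [AddCommMonoid N] (f : ι → N) :
    ∑ i, f i = ∑ i ∈ fixedPts σ, f i + ∑ i ∈ cycleReps σ, (f i + f (σ i) + f (σ (σ i))) := by
  have hpt : ∀ i, f i = (if σ i = i then f i else 0) +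
      ((if i < σ i ∧ i < σ (σ i) then f i else 0) +
        (if σ (σ i) < i ∧ σ (σ i) < σ i then f i else 0) +
        (if σ i < σ (σ i) ∧ σ i < i then f i else 0)) := by
    intro i
    have h3 := hσ i
    by_cases hfix : σ i = i
    · simp [hfix]
    · have h1 : σ (σ i) ≠ i := fun h => hfix (by rw [h] at h3; exact h3)
      have h2 : σ (σ i) ≠ σ i := fun h => hfix (σ.injective h)
      rcases lt_or_gt_of_ne hfix with a | a <;> rcases lt_or_gt_of_ne h1 with b | b <;>
        rcases lt_or_gt_of_ne h2 with c | c <;>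
        first
        | exact absurd (a.trans (b.trans c)) (lt_irrefl _)
        | exact absurd (a.trans (c.trans b)) (lt_irrefl _)
        | simp [hfix, a, b, c, a.not_gt, b.not_gt, c.not_gt]
  have h₁ : ∑ i, (if i < σ i ∧ i < σ (σ i) then f (σ i) else 0) =
      ∑ i, (if σ (σ i) < i ∧ σ (σ i) < σ i then f i else 0) := by
    rw [← Equiv.sum_comp σ fun i => if σ (σ i) < i ∧ σ (σ i) < σ i then f i else 0]
    simp only [hσ]
  have h₂ : ∑ i, (if i < σ i ∧ i < σ (σ i) then f (σ (σ i)) else 0) =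
      ∑ i, (if σ i < σ (σ i) ∧ σ i < i then f i else 0) := by
    rw [← Equiv.sum_comp (σ.trans σ) fun i => if σ i < σ (σ i) ∧ σ i < i then f i else 0]
    simp only [Equiv.trans_apply, hσ]
  rw [sum_congr rfl fun i _ => hpt i]
  simp only [fixedPts, cycleReps, sum_add_distrib, sum_filter, h₁, h₂]

theorem card_cycleReps (hσ : ∀ i, σ (σ (σ i)) = i) :
    Fintype.card ι = #(fixedPts σ) + 3 * #(cycleReps σ) := by
  have := sum_eq_sum_fixedPts_add_sum_cycleReps hσ (fun _ => 1)
  simpa [mul_comm] using this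

theorem disjoint_fixedPts_cycleReps : Disjoint (fixedPts σ) (cycleReps σ) := by
  rw [disjoint_left]
  intro i hi hi'
  simp only [fixedPts, cycleReps, mem_filter] at hi hi'
  exact absurd hi'.2.1 (by simp [hi.2])

theorem two_mul_finrank_le_of_fixed (hσ : ∀ i, σ (σ (σ i)) = i)
    (F : Submodule (ZMod 2) (ι → ZMod 2)) (hF : ∀ v ∈ F, v ∘ σ = v)
    (horth : ∀ u ∈ F, ∀ v ∈ F, ∑ i, u i * v i = 0) :
    2 * Module.finrank (ZMod 2) F ≤ #(fixedPts σ) + #(cycleReps σ) := by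
  let T := fixedPts σ ∪ cycleReps σ
  let res : (ι → ZMod 2) →ₗ[ZMod 2] (T → ZMod 2) := LinearMap.funLeft _ _ Subtype.val
  have hfix : ∀ v ∈ F, ∀ i, v (σ i) = v i := fun v hv i => congrFun (hF v hv) i
  have hres : ∀ u ∈ F, ∀ v ∈ F, ∑ t, res u t * res v t = 0 := by
    intro u hu v hv
    have h := horth u hu v hv
    rw [sum_eq_sum_fixedPts_add_sum_cycleReps hσ] at h
    simp only [hfix u hu, hfix v hv, CharTwo.add_self_eq_zero, zero_add] at h
    rw [← sum_union disjoint_fixedPts_cycleReps] at h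
    rw [← h]
    exact sum_coe_sort T fun i => u i * v i
  have hinj : Function.Injective (res.domRestrict F) := by
    rw [← LinearMap.ker_eq_bot, eq_bot_iff]
    rintro ⟨v, hv⟩ h0
    have hT : ∀ t ∈ T, v t = 0 := fun t ht => congrFun h0 ⟨t, ht⟩
    have hsum := sum_eq_sum_fixedPts_add_sum_cycleReps hσ fun i => (if v i ≠ 0 then 1 else 0 : ℕ)
    rw [sum_eq_zero (s := fixedPts σ) fun i hi => by simp [hT i (mem_union_left _ hi)],
      sum_eq_zero (s := cycleReps σ) fun i hi => by
        simp [hfix v hv, hT i (mem_union_right _ hi)]] at hsum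
    simp only [add_zero, sum_eq_zero_iff, mem_univ, true_imp_iff] at hsum
    exact Subtype.ext (funext fun i => by simpa using hsum i)
  have hle := two_mul_finrank_le_card_of_selfOrthogonal (F.map res) (by
    rintro _ ⟨u, hu, rfl⟩ _ ⟨v, hv, rfl⟩
    exact hres u hu v hv)
  rw [← LinearMap.range_domRestrict, LinearMap.finrank_range_of_inj hinj, Fintype.card_coe,
    card_union_of_disjoint disjoint_fixedPts_cycleReps] at hle
  exact hle

/-- The quaternary word attached to a binary word, one coordinate for each 3-cycle. -/
def toF4 (σ : Equiv.Perm ι) : (ι → ZMod 2) →+ (cycleReps σ → F4) where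
  toFun v j := F4.ofBit (v j) + F4.ofBit (v (σ j)) * F4.ω + F4.ofBit (v (σ (σ j))) * F4.ω ^ 2
  map_zero' := by ext; simp
  map_add' u v := by ext; simp; ring

theorem toF4_apply (v : ι → ZMod 2) (j : cycleReps σ) :
    toF4 σ v j =
      F4.ofBit (v j) + F4.ofBit (v (σ j)) * F4.ω + F4.ofBit (v (σ (σ j))) * F4.ω ^ 2 := rfl

theorem toF4_comp (hσ : ∀ i, σ (σ (σ i)) = i) (v : ι → ZMod 2) :
    toF4 σ (v ∘ σ ∘ σ) = F4.ω • toF4 σ v := by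
  have hω : F4.ω ^ 3 = 1 := by decide
  ext j
  simp only [toF4_apply, Pi.smul_apply, smul_eq_mul, Function.comp_apply, hσ]
  linear_combination -F4.ofBit (v (σ (σ j))) * hω

theorem eq_zero_of_mem_fixedPts {v : ι → ZMod 2} (hv : cycleSum σ v = 0) {i : ι}
    (hi : i ∈ fixedPts σ) : v i = 0 := by
  have h := congrFun hv i
  rw [cycleSum_apply, (mem_filter.1 hi).2, (mem_filter.1 hi).2, CharTwo.add_self_eq_zero,
    zero_add] at h
  exact h

theorem wt_le_two_mul_hammingNorm (hσ : ∀ i, σ (σ (σ i)) = i) {v : ι → ZMod 2}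
    (hv : cycleSum σ v = 0) : wt v ≤ 2 * hammingNorm (toF4 σ v) := by
  rw [wt, card_filter, sum_eq_sum_fixedPts_add_sum_cycleReps hσ,
    sum_eq_zero fun i hi => by simp [eq_zero_of_mem_fixedPts hv hi], zero_add, hammingNorm,
    card_filter, mul_sum, ← sum_coe_sort]
  exact sum_le_sum fun j _ => F4.weight_le _ _ _ (congrFun hv j)

theorem sum_toF4_mul_sq (hσ : ∀ i, σ (σ (σ i)) = i) {u v : ι → ZMod 2}
    (hu : cycleSum σ u = 0) (h₀ : ∑ i, u i * v i = 0) (h₁ : ∑ i, u i * v (σ i) = 0)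
    (h₂ : ∑ i, u i * v (σ (σ i)) = 0) :
    ∑ j, toF4 σ u j * toF4 σ v j ^ 2 = 0 := by
  have hfix : ∀ w : ι → ZMod 2, ∑ i ∈ fixedPts σ, u i * w i = 0 := fun w =>
    sum_eq_zero fun i hi => by rw [eq_zero_of_mem_fixedPts hu hi, zero_mul]
  rw [sum_eq_sum_fixedPts_add_sum_cycleReps hσ, hfix fun i => v i, zero_add] at h₀
  rw [sum_eq_sum_fixedPts_add_sum_cycleReps hσ, hfix fun i => v (σ i), zero_add] at h₁
  rw [sum_eq_sum_fixedPts_add_sum_cycleReps hσ, hfix fun i => v (σ (σ i)), zero_add] at h₂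
  simp only [hσ, ← sum_coe_sort (cycleReps σ)] at h₀ h₁ h₂
  simp only [toF4_apply, F4.hermitian_expand, sum_add_distrib, ← sum_mul, ← map_sum]
  simp only [← sum_add_distrib, h₀, h₁, h₂, map_zero, zero_mul, add_zero]

end cycles

/-- There is no binary self-dual [48,24,10] code with an automorphism of order 3
of type 3-(12,12), i.e. with twelve 3-cycles and twelve fixed points. -/
theorem statement5 :
    ¬ ∃ (C : Submodule (ZMod 2) (Fin 48 → ZMod 2)) (σ : Equiv.Perm (Fin 48)),
      C = dualCode C ∧
      Module.finrank (ZMod 2) C = 24 ∧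
      (∀ v ∈ C, v ≠ 0 → 10 ≤ wt v) ∧ (∃ v ∈ C, wt v = 10) ∧
      (∀ v, v ∈ C ↔ v ∘ σ ∈ C) ∧
      orderOf σ = 3 ∧
      (Finset.univ.filter fun i => σ i = i).card = 12 := by
  rintro ⟨C, σ, hdual, hfin, hmin, -, haut, hord, hfix⟩
  have hσ : ∀ i, σ (σ (σ i)) = i := by
    intro i
    have h := pow_orderOf_eq_one σ
    rw [hord] at h
    exact congrArg (fun τ : Equiv.Perm (Fin 48) => τ i) h
  have horth : ∀ u ∈ C, ∀ v ∈ C, ∑ i, u i * v i = 0 := fun u hu v hv => by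
    rw [hdual] at hu
    exact hu v hv
  have hcomp : ∀ v ∈ C, v ∘ σ ∈ C := fun v hv => (haut v).1 hv
  have hcomp₂ : ∀ v ∈ C, v ∘ σ ∘ σ ∈ C := fun v hv => hcomp _ (hcomp v hv)
  have hcard : #(cycleReps σ) = 12 := by
    have h := card_cycleReps hσ
    rw [Fintype.card_fin, fixedPts, hfix] at h
    omega
  let T := (cycleSum σ).domRestrict C
  have hrange : 2 * Module.finrank (ZMod 2) (LinearMap.range T) ≤ 24 := by
    have hmem : ∀ w ∈ LinearMap.range T, w ∈ C := by
      rintro _ ⟨⟨v, hv⟩, rfl⟩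
      exact C.add_mem (C.add_mem hv (hcomp v hv)) (hcomp₂ v hv)
    have h := two_mul_finrank_le_of_fixed hσ (LinearMap.range T) (by
      rintro _ ⟨⟨v, hv⟩, rfl⟩
      funext i
      change cycleSum σ v (σ i) = cycleSum σ v i
      rw [cycleSum_apply, cycleSum_apply, hσ]
      ring) fun u hu v hv => horth u (hmem u hu) v (hmem v hv)
    rwa [hcard, fixedPts, hfix] at h
  have hker : 12 ≤ Module.finrank (ZMod 2) (LinearMap.ker T) := by
    have h := LinearMap.finrank_range_add_finrank_ker T
    omega
  have hE : ∀ v : LinearMap.ker T, cycleSum σ (v : C) = 0 := fun v => v.2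
  let D : Submodule F4 (cycleReps σ → F4) :=
    { carrier := {x | ∃ v ∈ C, cycleSum σ v = 0 ∧ toF4 σ v = x}
      add_mem' := by
        rintro _ _ ⟨u, hu, hu0, rfl⟩ ⟨v, hv, hv0, rfl⟩
        exact ⟨u + v, C.add_mem hu hv, by rw [map_add, hu0, hv0, add_zero], map_add _ _ _⟩
      zero_mem' := ⟨0, C.zero_mem, map_zero _, map_zero _⟩
      smul_mem' := by
        have hω : ∀ x, (∃ v ∈ C, cycleSum σ v = 0 ∧ toF4 σ v = x) →
            ∃ v ∈ C, cycleSum σ v = 0 ∧ toF4 σ v = F4.ω • x := by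
          rintro _ ⟨v, hv, hv0, rfl⟩
          refine ⟨v ∘ σ ∘ σ, hcomp₂ v hv, ?_, toF4_comp hσ v⟩
          funext i
          exact congrFun hv0 (σ (σ i))
        intro c x hx
        rcases F4.eq_zero_or_eq_pow_ω c with rfl | rfl | rfl | rfl
        · exact ⟨0, C.zero_mem, map_zero _, by rw [map_zero, zero_smul]⟩
        · rwa [one_smul]
        · exact hω x hx
        · rw [mul_smul]
          exact hω _ (hω x hx) }
  have hnorm : ∀ v ∈ C, cycleSum σ v = 0 → v ≠ 0 → 5 ≤ hammingNorm (toF4 σ v) := by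
    intro v hv hv0 hne
    have h1 := hmin v hv hne
    have h2 := wt_le_two_mul_hammingNorm hσ hv0
    omega
  have hdim : 6 ≤ Module.finrank F4 D := by
    let g : LinearMap.ker T → D := fun v => ⟨toF4 σ (v : C), v, (v : C).2, hE v, rfl⟩
    have hg : Function.Injective g := by
      intro u v huv
      have h0 : toF4 σ ((u - v : LinearMap.ker T) : C) = 0 := by
        have h : toF4 σ (u : C) = toF4 σ (v : C) := congrArg Subtype.val huv
        simp [h]
      by_contra hne
      have h5 := hnorm _ ((u - v : LinearMap.ker T) : C).2 (hE (u - v)) fun h =>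
        hne (sub_eq_zero.1 (Subtype.ext (Subtype.ext h)))
      rw [h0, hammingNorm_zero] at h5
      omega
    have hle := Nat.card_le_card_of_injective g hg
    rw [Module.natCard_eq_pow_finrank (K := ZMod 2) (V := LinearMap.ker T),
      Module.natCard_eq_pow_finrank (K := F4) (V := D),
      Nat.card_zmod, Nat.card_eq_fintype_card (α := F4), F4.card_eq, show 4 = 2 ^ 2 from rfl,
      ← pow_mul, Nat.pow_le_pow_iff_right (by norm_num)] at hle
    omega
  refine no_hermitian_selfDual (by rw [Fintype.card_coe, hcard]) D hdim ?_ ?_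
  · rintro _ ⟨u, hu, hu0, rfl⟩ _ ⟨v, hv, hv0, rfl⟩
    exact sum_toF4_mul_sq hσ hu0 (horth u hu v hv) (horth u hu _ (hcomp v hv))
      (horth u hu _ (hcomp₂ v hv))
  · rintro _ ⟨v, hv, hv0, rfl⟩ hne
    exact hnorm v hv hv0 fun h => hne (by rw [h, map_zero])
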